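/- Let D be a triangulated category with a split generator, and let F₁, F₂ be endofunctors of D such that the compositions F₁∘F₂ and F₂∘F₁ are not virtually zero. Then for every t ∈ ℝ at which h_t(F₁∘F₂) ≠ −∞, one has h^pol_t(F₁∘F₂) = h^pol_t(F₂∘F₁). In particular, if F₁ is a triangulated autoequivalence of D, then h^pol_t(F₁∘F₂∘F₁⁻¹) = h^pol_t(F₂), i.e. categorical polynomial entropy is invariant under conjugation. -/

import Mathlib

open CategoryTheory Category Limits Pretriangulated Filter Topology
open scoped ENNReal

universe v u

namespace CatDyn

variable {D : Type u} [Category.{v} D] [Limits.HasZeroObject D] [Preadditive D]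
  [HasShift D ℤ] [∀ n : ℤ, (CategoryTheory.shiftFunctor D n).Additive] [Pretriangulated D]
  [HasBinaryBiproducts D]

/-- A tower `0 = A₀ → A₁ → ⋯ → A_m ≅ N ⊕ N'` with cones shifts of `M`,
computing the complexity of `N` with respect to `M`. -/
structure Tower (M N : D) where
  m : ℕ
  A : Fin (m + 1) → D
  f : ∀ i : Fin m, A i.castSucc ⟶ A i.succ
  shifts : Fin m → ℤ
  N' : D
  isZero_zero : IsZero (A 0)
  lastIso : A (Fin.last m) ≅ N ⊞ N'
  dist : ∀ i : Fin m, ∃ (g : A i.succ ⟶ M⟦shifts i⟧) (h : M⟦shifts i⟧ ⟶ (A i.castSucc)⟦(1 : ℤ)⟧),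
    Triangle.mk (f i) g h ∈ distTriang D

/-- The value `Σ_k e^{n_k t}` of a tower. -/
noncomputable def Tower.value {M N : D} (t : ℝ) (T : Tower M N) : ℝ≥0∞ :=
  ∑ i : Fin T.m, ENNReal.ofReal (Real.exp (T.shifts i * t))

/-- The complexity function `δ_t(M,N)`, valued in `[0,∞]`; it is `∞` iff no tower exists,
i.e. iff `N` is not in the thick triangulated subcategory generated by `M`. -/
noncomputable def complexity (t : ℝ) (M N : D) : ℝ≥0∞ :=
  ⨅ T : Tower M N, T.value t

/-- `G` is a split generator: every object admits a tower over `G`, i.e. the thick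
triangulated subcategory generated by `G` is all of `D`. -/
def IsSplitGenerator (G : D) : Prop := ∀ N : D, Nonempty (Tower G N)

/-- The `n`-th iterate of an endofunctor. -/
def fpow (F : D ⥤ D) : ℕ → D ⥤ D
  | 0 => 𝟭 D
  | n + 1 => fpow F n ⋙ F

/-- `F` is not virtually zero: no positive iterate is the zero functor. -/
def NotVirtuallyZero (F : D ⥤ D) : Prop := ∀ n : ℕ, 0 < n → ¬ IsZero (fpow F n)

/-- The categorical entropy `h_t(F) ∈ [-∞,∞)`, computed with split generator `G`
(the limit exists and is independent of the generator). -/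
noncomputable def entropy (t : ℝ) (F : D ⥤ D) (G : D) : EReal :=
  limsup (fun n : ℕ =>
    ENNReal.log (complexity t G ((fpow F n).obj G)) * (((n : ℝ)⁻¹ : ℝ) : EReal)) atTop

/-- The categorical polynomial entropy
`h^pol_t(F) = limsup (log δ_t(G, Fⁿ G) - n h_t(F)) / log n`. -/
noncomputable def polyEntropy (t : ℝ) (F : D ⥤ D) (G : D) : EReal :=
  limsup (fun n : ℕ =>
    (ENNReal.log (complexity t G ((fpow F n).obj G)) - ((n : ℝ) : EReal) * entropy t F G)
      * ((((Real.log n)⁻¹ : ℝ)) : EReal)) atTop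

/-- The lower categorical polynomial entropy (with `liminf` instead of `limsup`). -/
noncomputable def polyEntropyLow (t : ℝ) (F : D ⥤ D) (G : D) : EReal :=
  liminf (fun n : ℕ =>
    (ENNReal.log (complexity t G ((fpow F n).obj G)) - ((n : ℝ) : EReal) * entropy t F G)
      * ((((Real.log n)⁻¹ : ℝ)) : EReal)) atTop

section Linear

variable (𝕜 : Type*) [Field 𝕜] [Linear 𝕜 D]

/-- The Ext-distance `ε_t(M,N) = Σ_{k∈ℤ} dim Hom(M, N[k]) e^{-kt}`. -/
noncomputable def extDist (t : ℝ) (M N : D) : ℝ≥0∞ :=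
  ∑' k : ℤ, (Module.finrank 𝕜 (M ⟶ N⟦k⟧) : ℝ≥0∞) * ENNReal.ofReal (Real.exp (-k * t))

variable (D) in
/-- `D` is Hom-finite over `𝕜`. -/
def HomFinite : Prop := ∀ X Y : D, FiniteDimensional 𝕜 (X ⟶ Y)

variable (D) in
/-- `D` is Ext-bounded: `Hom(X, Y[k]) = 0` for all but finitely many `k`. -/
def ExtBounded : Prop := ∀ X Y : D, {k : ℤ | ∃ f : X ⟶ Y⟦k⟧, f ≠ 0}.Finite

variable (D) in
/-- The comparability property: `δ_t` and `ε_t` control each other, uniformly in the objects. -/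
def Comparability : Prop :=
  ∃ C₁ C₂ : ℝ → ℝ, (∀ t, 0 < C₁ t ∧ 0 < C₂ t) ∧
    ∀ (t : ℝ) (M N : D),
      ENNReal.ofReal (C₁ t) * extDist 𝕜 t M N ≤ complexity t M N ∧
      complexity t M N ≤ ENNReal.ofReal (C₂ t) * extDist 𝕜 t M N

end Linear

set_option linter.unusedSectionVars false

/-- `B` is an extension of `C` by `A`: there is a distinguished triangle `A ⟶ B ⟶ C ⟶ A⟦1⟧`. -/
def IsExtension (C A B : D) : Prop :=
  ∃ (f : A ⟶ B) (g : B ⟶ C) (h : C ⟶ A⟦(1 : ℤ)⟧), Triangle.mk f g h ∈ distTriang D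

/-- A product of two objects indexed by `WalkingPair` is their biproduct. -/
noncomputable def piWalkingPairIso (Q : WalkingPair → D) [HasProduct Q] :
    ∏ᶜ Q ≅ Q .left ⊞ Q .right where
  hom := biprod.lift (Pi.π Q .left) (Pi.π Q .right)
  inv := Pi.lift fun j => match j with
    | .left => biprod.fst
    | .right => biprod.snd
  hom_inv_id := by
    refine Pi.hom_ext _ _ ?_
    rintro (_ | _) <;> simp
  inv_hom_id := by
    ext <;> simp

/-- Adding a zero object does not change the isomorphism class. -/
noncomputable def zeroBiprodIso {Z : D} (hZ : IsZero Z) (X : D) : Z ⊞ X ≅ X where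
  hom := biprod.snd
  inv := biprod.inr
  hom_inv_id := by
    apply biprod.hom_ext
    · exact hZ.eq_of_tgt _ _
    · simp
  inv_hom_id := by simp

namespace IsExtension

lemma congr {C A B C' A' B' : D} (h : IsExtension C A B) (eC : C ≅ C') (eA : A ≅ A')
    (eB : B ≅ B') : IsExtension C' A' B' := by
  obtain ⟨f, g, h, H⟩ := h
  refine ⟨eA.inv ≫ f ≫ eB.hom, eB.inv ≫ g ≫ eC.hom, eC.inv ≫ h ≫ eA.hom⟦(1 : ℤ)⟧',
    isomorphic_distinguished _ H _ ?_⟩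
  have h₁ : (eA.inv ≫ f ≫ eB.hom) ≫ eB.inv = eA.inv ≫ f := by simp
  have h₂ : (eB.inv ≫ g ≫ eC.hom) ≫ eC.inv = eB.inv ≫ g := by simp
  have h₃ : (eC.inv ≫ h ≫ eA.hom⟦(1 : ℤ)⟧') ≫ eA.inv⟦(1 : ℤ)⟧' = eC.inv ≫ h := by
    simp [← Functor.map_comp]
  exact Triangle.isoMk _ _ eA.symm eB.symm eC.symm h₁ h₂ h₃

lemma map (F : D ⥤ D) [F.CommShift ℤ] [F.IsTriangulated] {C A B : D} (h : IsExtension C A B) :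
    IsExtension (F.obj C) (F.obj A) (F.obj B) := by
  obtain ⟨f, g, h, H⟩ := h
  exact ⟨_, _, _, F.map_distinguished _ H⟩

lemma shift {C A B : D} (h : IsExtension C A B) (n : ℤ) :
    IsExtension (C⟦n⟧) (A⟦n⟧) (B⟦n⟧) := by
  obtain ⟨f, g, h, H⟩ := h
  exact ⟨_, _, _, Triangle.shift_distinguished _ H n⟩

lemma biprod {C A B : D} (h : IsExtension C A B) (X : D) :
    IsExtension C (X ⊞ A) (X ⊞ B) := by
  obtain ⟨f, g, h, H⟩ := h
  let T : WalkingPair → Triangle D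
    | .left => contractibleTriangle X
    | .right => Triangle.mk f g h
  have hT : ∀ j, T j ∈ distTriang D
    | .left => contractible_distinguished X
    | .right => H
  have key := productTriangle_distinguished T hT
  have : IsExtension (∏ᶜ fun j => (T j).obj₃) (∏ᶜ fun j => (T j).obj₁)
    (∏ᶜ fun j => (T j).obj₂) := ⟨_, _, _, key⟩
  exact this.congr (piWalkingPairIso _ ≪≫ zeroBiprodIso (isZero_zero D) C) (piWalkingPairIso _)
    (piWalkingPairIso _)

lemma of_isZero {C A : D} (hA : IsZero A) : IsExtension C A C :=
  IsExtension.congr ⟨_, _, _, contractible_distinguished₁ C⟩ (Iso.refl C)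
    ((isZero_zero D).iso hA) (Iso.refl C)

end IsExtension

/-- `Reach t M A c` means that `A` is the top of a tower of extensions by shifts of `M`
whose weight is `c`. -/
inductive Reach (t : ℝ) (M : D) : D → ℝ≥0∞ → Prop
  | zero {A : D} (hA : IsZero A) : Reach t M A 0
  | step {A B : D} {c : ℝ≥0∞} (n : ℤ) (h : Reach t M A c) (hE : IsExtension (M⟦n⟧) A B) :
      Reach t M B (c + ENNReal.ofReal (Real.exp (n * t)))

namespace Reach

variable {t : ℝ} {M : D}

lemma of_iso {A B : D} {c : ℝ≥0∞} (h : Reach t M A c) (e : A ≅ B) : Reach t M B c := by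
  cases h with
  | zero hA => exact .zero (hA.of_iso e.symm)
  | step n h hE => exact .step n h (hE.congr (Iso.refl _) (Iso.refl _) e)

lemma biprod {A B : D} {c d : ℝ≥0∞} (hA : Reach t M A c) (hB : Reach t M B d) :
    Reach t M (A ⊞ B) (c + d) := by
  induction hB with
  | zero hB =>
    rw [add_zero]
    exact hA.of_iso ((zeroBiprodIso hB A).symm ≪≫ biprod.braiding _ _)
  | step n h hE ih =>
    rw [← add_assoc]
    exact .step n ih (hE.biprod A)

lemma single (n : ℤ) : Reach t M (M⟦n⟧) (ENNReal.ofReal (Real.exp (n * t))) := by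
  simpa using Reach.step (t := t) n (.zero (isZero_zero D)) (.of_isZero (isZero_zero D))

lemma shift {A : D} {c : ℝ≥0∞} (h : Reach t M A c) (k : ℤ) :
    Reach t M (A⟦k⟧) (ENNReal.ofReal (Real.exp (k * t)) * c) := by
  induction h with
  | zero hA =>
    rw [mul_zero]
    exact .zero ((shiftFunctor D k).map_isZero hA)
  | step n h hE ih =>
    have := ih.step (n + k) ((hE.shift k).congr ((shiftFunctorAdd D n k).app M).symm
      (Iso.refl _) (Iso.refl _))
    convert this using 1
    rw [mul_add, ← ENNReal.ofReal_mul (Real.exp_nonneg _), ← Real.exp_add]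
    push_cast
    ring_nf

lemma map (F : D ⥤ D) [F.CommShift ℤ] [F.IsTriangulated] {A : D} {c : ℝ≥0∞}
    (h : Reach t M A c) : Reach t (F.obj M) (F.obj A) c := by
  induction h with
  | zero hA => exact .zero (F.map_isZero hA)
  | step n h hE ih =>
    exact .step n ih ((hE.map F).congr ((F.commShiftIso n).app M) (Iso.refl _) (Iso.refl _))

lemma of_tower {N : D} (T : Tower M N) : Reach t M (T.A (Fin.last T.m)) (T.value t) := by
  have key : ∀ k (hk : k ≤ T.m), Reach t M (T.A ⟨k, by omega⟩)
      (∑ i : Fin k, ENNReal.ofReal (Real.exp (T.shifts ⟨i, by omega⟩ * t))) := by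
    intro k
    induction k with
    | zero =>
      intro _
      simpa using Reach.zero T.isZero_zero
    | succ k ih =>
      intro hk
      rw [Fin.sum_univ_castSucc]
      exact .step _ (ih (by omega)) ⟨_, T.dist ⟨k, hk⟩⟩
  exact key T.m le_rfl

lemma exists_chain {A : D} {c : ℝ≥0∞} (h : Reach t M A c) :
    ∃ (m : ℕ) (X : ℕ → D) (s : ℕ → ℤ), IsZero (X 0) ∧ X m = A ∧
      (∀ i < m, IsExtension (M⟦s i⟧) (X i) (X (i + 1))) ∧
      c = ∑ i : Fin m, ENNReal.ofReal (Real.exp (s i * t)) := by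
  induction h with
  | @zero A hA => exact ⟨0, fun _ => A, 0, hA, rfl, by simp, by simp⟩
  | @step A B c n h hE ih =>
    obtain ⟨m, X, s, h₀, rfl, hX, rfl⟩ := ih
    refine ⟨m + 1, fun k => if k ≤ m then X k else B, fun k => if k < m then s k else n,
      by simpa, by simp, ?_, ?_⟩
    · intro i hi
      rcases Nat.lt_succ_iff_lt_or_eq.mp hi with hi | rfl
      · simpa [hi, hi.le, Nat.succ_le_of_lt hi] using hX i hi
      · simpa using hE
    · rw [Fin.sum_univ_castSucc]
      simp

lemma exists_tower {A N N' : D} {c : ℝ≥0∞} (h : Reach t M A c) (e : A ≅ N ⊞ N') :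
    ∃ T : Tower M N, T.value t = c := by
  obtain ⟨m, X, s, h₀, rfl, hX, rfl⟩ := h.exists_chain
  choose f hf using fun i : Fin m => hX i i.2
  exact ⟨⟨m, fun i => X i, f, fun i => s i, N', h₀, e, hf⟩, rfl⟩

end Reach

lemma exists_iso_biprod_of_retract {N A : D} (r : Retract N A) :
    ∃ N' : D, Nonempty (A ≅ N ⊞ N') := by
  obtain ⟨C, g, h, H⟩ := distinguished_cocone_triangle r.i
  have : Mono r.i := ⟨fun a b hab => by
    simpa [Retract.retract] using congrArg (· ≫ r.r) hab⟩
  have h0 : h = 0 := Triangle.mor₃_eq_zero_of_mono₁ _ H this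
  obtain ⟨e, -, -⟩ := exists_iso_binaryBiproduct_of_distTriang _ H h0
  exact ⟨C, ⟨e⟩⟩

/-- A biproduct retracts onto its first summand. -/
noncomputable def retractBiprodLeft (X Y : D) : Retract X (X ⊞ Y) where
  i := biprod.inl
  r := biprod.fst

/-- Biproducts of retracts are retracts. -/
noncomputable def retractBiprodMap {X Y A B : D} (r : Retract X A) (s : Retract Y B) :
    Retract (X ⊞ Y) (A ⊞ B) where
  i := biprod.map r.i s.i
  r := biprod.map r.r s.r

namespace Tower

/-- The summand `N` is a retract of the top of the tower. -/
noncomputable def retract {M N : D} (T : Tower M N) : Retract N (T.A (Fin.last T.m)) :=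
  (retractBiprodLeft N T.N').trans (.ofIso T.lastIso.symm)

end Tower

section Complexity

variable {t : ℝ} {M : D}

lemma Reach.complexity_le {A N : D} {c : ℝ≥0∞} (h : Reach t M A c) (r : Retract N A) :
    complexity t M N ≤ c := by
  obtain ⟨N', ⟨e⟩⟩ := exists_iso_biprod_of_retract r
  obtain ⟨T, rfl⟩ := h.exists_tower e
  exact iInf_le _ T

lemma complexity_le_of_retract {N P : D} (r : Retract P N) :
    complexity t M P ≤ complexity t M N :=
  le_iInf fun T => (Reach.of_tower T).complexity_le (r.trans T.retract)

lemma complexity_congr {N P : D} (e : N ≅ P) : complexity t M N = complexity t M P :=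
  le_antisymm (complexity_le_of_retract (.ofIso e)) (complexity_le_of_retract (.ofIso e.symm))

lemma complexity_biprod_le (X Y : D) :
    complexity t M (X ⊞ Y) ≤ complexity t M X + complexity t M Y := by
  refine ENNReal.le_iInf_add_iInf fun T S => ?_
  exact ((Reach.of_tower T).biprod (Reach.of_tower S)).complexity_le
    (retractBiprodMap T.retract S.retract)

lemma complexity_le_of_isExtension {X Y : D} (n : ℤ) (h : IsExtension (M⟦n⟧) X Y) :
    complexity t M Y ≤ complexity t M X + ENNReal.ofReal (Real.exp (n * t)) := by
  rw [complexity, complexity, ENNReal.iInf_add]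
  refine le_iInf fun T => ?_
  have := h.biprod T.N'
  refine (((Reach.of_tower T).of_iso
    (T.lastIso ≪≫ biprod.braiding _ _)).step n this).complexity_le ?_
  exact (retractBiprodLeft Y T.N').trans (.ofIso (biprod.braiding _ _))

lemma complexity_shift_le (N : D) (k : ℤ) :
    complexity t M (N⟦k⟧) ≤ ENNReal.ofReal (Real.exp (k * t)) * complexity t M N := by
  rw [complexity, complexity, ENNReal.mul_iInf_of_ne (by simp [Real.exp_pos]) (by simp)]
  exact le_iInf fun T => ((Reach.of_tower T).shift k).complexity_le
    (T.retract.map (shiftFunctor D k))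

lemma complexity_shift_self_le (n : ℤ) :
    complexity t M (M⟦n⟧) ≤ ENNReal.ofReal (Real.exp (n * t)) :=
  (Reach.single n).complexity_le (.refl _)

lemma complexity_of_isZero {N : D} (hN : IsZero N) : complexity t M N = 0 :=
  le_antisymm ((Reach.zero hN).complexity_le (.refl _)) bot_le

end Complexity

namespace IsDistTriang

variable {A B C : D} {f : A ⟶ B} {g : B ⟶ C} {h : C ⟶ A⟦(1 : ℤ)⟧}

lemma zero₁₂ (H : Triangle.mk f g h ∈ distTriang D) : f ≫ g = 0 :=
  comp_distTriang_mor_zero₁₂ _ H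

lemma zero₂₃ (H : Triangle.mk f g h ∈ distTriang D) : g ≫ h = 0 :=
  comp_distTriang_mor_zero₂₃ _ H

lemma exists_desc₂ (H : Triangle.mk f g h ∈ distTriang D) {T : D} (k : B ⟶ T)
    (hk : f ≫ k = 0) : ∃ l : C ⟶ T, k = g ≫ l :=
  Triangle.yoneda_exact₂ _ H k hk

lemma exists_desc₃ (H : Triangle.mk f g h ∈ distTriang D) {T : D} (k : C ⟶ T)
    (hk : g ≫ k = 0) : ∃ l : A⟦(1 : ℤ)⟧ ⟶ T, k = h ≫ l :=
  Triangle.yoneda_exact₃ _ H k hk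

end IsDistTriang

open IsDistTriang

section Attach

variable {t : ℝ} {M : D}

/-- Along a tower with top `A`, a map `d : B ⟶ X` can be pushed out weakly along some `B ⟶ W`
that kills a given `A ⟶ B`, at a cost bounded by the weight of the tower. -/
lemma Reach.exists_weakPushout {A : D} {c : ℝ≥0∞} (hA : Reach t M A c) :
    ∀ {B : D} (a : A ⟶ B) {X : D} (d : B ⟶ X),
      ∃ (W : D) (w : B ⟶ W) (E : D) (i : X ⟶ E) (f : W ⟶ E),
        a ≫ w = 0 ∧ d ≫ i = w ≫ f ∧
        (∀ {T : D} (s : X ⟶ T) (u : W ⟶ T), d ≫ s = w ≫ u →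
          ∃ e : E ⟶ T, i ≫ e = s ∧ f ≫ e = u) ∧
        complexity t M E ≤ complexity t M X + 2 * (ENNReal.ofReal (Real.exp t) * c) := by
  induction hA with
  | zero hA =>
    intro B a X d
    exact ⟨B, 𝟙 B, X, 𝟙 X, d, hA.eq_of_src _ _, by simp,
      fun s u h => ⟨s, by simp, by simpa using h⟩, by simp⟩
  | @step A A' c n hA hE ih =>
    intro B a X d
    obtain ⟨σ, q, r, hT⟩ := hE
    obtain ⟨W, w, E, i, f, haw, hdi, hpush, hcost⟩ := ih (σ ≫ a) d
    obtain ⟨u, hu⟩ := exists_desc₂ hT (a ≫ w) (by simpa using haw)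
    obtain ⟨W', w', h, hW⟩ := distinguished_cocone_triangle u
    obtain ⟨E', g, k, hE⟩ := distinguished_cocone_triangle (u ≫ f)
    have huw : u ≫ w' = 0 := zero₁₂ hW
    obtain ⟨f', hf'⟩ := exists_desc₂ hW (f ≫ g) (by simpa using zero₁₂ hE)
    have hwh : w' ≫ h = 0 := zero₂₃ hW
    refine ⟨W', w ≫ w', E' ⊞ M⟦n⟧⟦(1 : ℤ)⟧, i ≫ g ≫ biprod.inl, biprod.lift f' h,
      ?_, ?_, ?_, ?_⟩
    · rw [← assoc, hu, assoc, huw, comp_zero]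
    · apply biprod.hom_ext
      · simp [reassoc_of% hdi, reassoc_of% hf']
      · simp [hwh]
    · intro T s v hsv
      obtain ⟨e, he₁, he₂⟩ := hpush s (w' ≫ v) (by simpa using hsv)
      obtain ⟨e', he'⟩ := exists_desc₂ hE e (by
        rw [assoc, he₂, reassoc_of% huw, zero_comp])
      obtain ⟨e'', he''⟩ := exists_desc₃ hW (v - f' ≫ e') (by
        rw [Preadditive.comp_sub, ← he₂, he', ← reassoc_of% hf', sub_self])
      refine ⟨biprod.desc e' e'', ?_, ?_⟩
      · simp [← he', he₁]
      · rw [biprod.lift_desc, ← he'']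
        abel
    · have hn : ENNReal.ofReal (Real.exp (((n + 1 : ℤ) : ℝ) * t)) =
          ENNReal.ofReal (Real.exp t) * ENNReal.ofReal (Real.exp (n * t)) := by
        rw [← ENNReal.ofReal_mul (Real.exp_nonneg _), ← Real.exp_add]
        push_cast
        ring_nf
      have e : M⟦n⟧⟦(1 : ℤ)⟧ ≅ M⟦n + 1⟧ := ((shiftFunctorAdd D n 1).app M).symm
      have h₁ : complexity t M E' ≤ complexity t M E +
          ENNReal.ofReal (Real.exp (((n + 1 : ℤ) : ℝ) * t)) :=
        complexity_le_of_isExtension _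
          (IsExtension.congr ⟨_, _, _, rot_of_distTriang _ hE⟩ e (Iso.refl _) (Iso.refl _))
      have h₂ : complexity t M (M⟦n⟧⟦(1 : ℤ)⟧) ≤
          ENNReal.ofReal (Real.exp (((n + 1 : ℤ) : ℝ) * t)) := by
        rw [complexity_congr e]
        exact complexity_shift_self_le _
      rw [hn] at h₁ h₂
      calc complexity t M (E' ⊞ M⟦n⟧⟦(1 : ℤ)⟧)
          ≤ _ := complexity_biprod_le _ _
        _ ≤ _ := add_le_add (h₁.trans (add_le_add_left hcost _)) h₂
        _ = _ := by ring

/-- The middle term of an extension of `U⟦1⟧` by `X`, presented by `d : U ⟶ X`. -/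
lemma complexity_le_of_distTriang {U X Y : D} {d : U ⟶ X} {x : X ⟶ Y} {h : Y ⟶ U⟦(1 : ℤ)⟧}
    (H : Triangle.mk d x h ∈ distTriang D) :
    complexity t M Y ≤ complexity t M X + 3 * (ENNReal.ofReal (Real.exp t) *
      complexity t M U) := by
  have key : ∀ T : Tower M U, complexity t M Y ≤ complexity t M X +
      2 * (ENNReal.ofReal (Real.exp t) * T.value t) + complexity t M (U⟦(1 : ℤ)⟧) := by
    intro T
    set j := T.retract.i
    set π := T.retract.r
    have hjπ : j ≫ π = 𝟙 U := T.retract.retract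
    obtain ⟨W, w, E, i, f, haw, hdi, hpush, hcost⟩ :=
      (Reach.of_tower (t := t) T).exists_weakPushout (𝟙 _) (π ≫ d)
    have hw : w = 0 := by simpa using haw
    have hdi : d ≫ i = 0 := by
      have : π ≫ d ≫ i = 0 := by simpa [hw] using hdi
      simpa [reassoc_of% hjπ] using congrArg (j ≫ ·) this
    obtain ⟨α, hα⟩ := exists_desc₂ H i hdi
    obtain ⟨β, hβ, -⟩ := hpush x 0 (by simp [zero₁₂ H])
    obtain ⟨γ, hγ⟩ := exists_desc₃ H (𝟙 Y - α ≫ β) (by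
      rw [Preadditive.comp_sub, comp_id, ← assoc, ← hα, hβ, sub_self])
    have r : Retract Y (E ⊞ U⟦(1 : ℤ)⟧) :=
      { i := biprod.lift α h
        r := biprod.desc β γ
        retract := by
          rw [biprod.lift_desc, ← hγ]
          abel }
    exact (complexity_le_of_retract r).trans
      ((complexity_biprod_le _ _).trans (add_le_add_left hcost _))
  have h₁ : complexity t M (U⟦(1 : ℤ)⟧) ≤ ENNReal.ofReal (Real.exp t) * complexity t M U := by
    simpa using complexity_shift_le (t := t) (M := M) U 1
  have h₂ : complexity t M Y ≤ complexity t M X +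
      2 * (ENNReal.ofReal (Real.exp t) * complexity t M U) + complexity t M (U⟦(1 : ℤ)⟧) := by
    change _ ≤ _ + 2 * (_ * ⨅ T : Tower M U, T.value t) + _
    rw [ENNReal.mul_iInf_of_ne (by simp [Real.exp_pos]) (by simp),
      ENNReal.mul_iInf_of_ne (by simp) (by simp), ENNReal.add_iInf, ENNReal.iInf_add]
    exact le_iInf key
  calc _ ≤ _ := h₂.trans (add_le_add_right h₁ _)
    _ = _ := by ring

lemma complexity_le_of_isExtension_shift {N X Y : D} (n : ℤ) (h : IsExtension (N⟦n⟧) X Y) :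
    complexity t M Y ≤ complexity t M X +
      3 * complexity t M N * ENNReal.ofReal (Real.exp (n * t)) := by
  obtain ⟨f, g, h, H⟩ := h
  have H' := complexity_le_of_distTriang (t := t) (M := M) (inv_rot_of_distTriang _ H)
  have e : N⟦n⟧⟦(-1 : ℤ)⟧ ≅ N⟦n + -1⟧ := ((shiftFunctorAdd D n (-1)).app N).symm
  refine H'.trans ?_
  have : ENNReal.ofReal (Real.exp t) * complexity t M (N⟦n⟧⟦(-1 : ℤ)⟧) ≤
      complexity t M N * ENNReal.ofReal (Real.exp (n * t)) := by
    rw [complexity_congr e]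
    calc _ ≤ _ := mul_le_mul_right (complexity_shift_le N (n + -1)) _
      _ = _ := by
        rw [← mul_assoc, ← ENNReal.ofReal_mul (Real.exp_nonneg _), ← Real.exp_add, mul_comm]
        push_cast
        ring_nf
  calc _ ≤ complexity t M X + 3 * (complexity t M N * ENNReal.ofReal (Real.exp (n * t))) :=
        add_le_add_right (mul_le_mul_right this 3) _
    _ = _ := by ring

/-- Complexities are submultiplicative up to the universal constant `3`. -/
lemma Reach.complexity_le_mul {N A : D} {c : ℝ≥0∞} (h : Reach t N A c) :
    complexity t M A ≤ 3 * complexity t M N * c := by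
  induction h with
  | zero hA => simp [complexity_of_isZero hA]
  | step n h hE ih =>
    rw [mul_add]
    exact (complexity_le_of_isExtension_shift n hE).trans (add_le_add_left ih _)

end Attach

/-- `F` carries towers over `M` to towers over `F.obj M` of the same weight. -/
def PreservesReach (t : ℝ) (F : D ⥤ D) : Prop :=
  ∀ ⦃M A : D⦄ ⦃c : ℝ≥0∞⦄, Reach t M A c → Reach t (F.obj M) (F.obj A) c

namespace PreservesReach

variable {t : ℝ}

lemma of_isTriangulated (F : D ⥤ D) [F.CommShift ℤ] [F.IsTriangulated] : PreservesReach t F :=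
  fun _ _ _ h => h.map F

lemma comp {F F' : D ⥤ D} (hF : PreservesReach t F) (hF' : PreservesReach t F') :
    PreservesReach t (F ⋙ F') :=
  fun _ _ _ h => hF' (hF h)

lemma fpow {F : D ⥤ D} (hF : PreservesReach t F) (n : ℕ) : PreservesReach t (fpow F n) := by
  induction n with
  | zero => exact fun _ _ _ h => h
  | succ n ih => exact ih.comp hF

lemma inverse (e : D ≌ D) [e.functor.CommShift ℤ] [e.functor.IsTriangulated] :
    PreservesReach t e.inverse := by
  let := e.toAdjunction.rightAdjointCommShift ℤ
  have := e.toAdjunction.commShift_of_leftAdjoint ℤ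
  have := e.toAdjunction.isTriangulated_rightAdjoint
  exact of_isTriangulated _

lemma complexity_le_tower {F : D ⥤ D} (hF : PreservesReach t F) (G : D) {M N : D}
    (T : Tower M N) :
    complexity t G (F.obj N) ≤ 3 * complexity t G (F.obj M) * T.value t :=
  (complexity_le_of_retract (T.retract.map F)).trans (hF (.of_tower T)).complexity_le_mul

end PreservesReach

lemma Tower.value_ne_top {M N : D} (t : ℝ) (T : Tower M N) : T.value t ≠ ⊤ :=
  (ENNReal.sum_lt_top.mpr fun _ _ => ENNReal.ofReal_lt_top).ne

lemma IsSplitGenerator.complexity_ne_top {G : D} (hG : IsSplitGenerator G) (t : ℝ) (N : D) :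
    complexity t G N ≠ ⊤ := by
  obtain ⟨T⟩ := hG N
  exact ne_top_of_le_ne_top (T.value_ne_top t) (iInf_le _ T)

lemma IsSplitGenerator.exists_complexity_le {G : D} (hG : IsSplitGenerator G) {t : ℝ}
    {F : D ⥤ D} (hF : PreservesReach t F) (N : D) :
    ∃ C : ℝ≥0∞, C ≠ ⊤ ∧ ∀ H : D ⥤ D, PreservesReach t H →
      complexity t G (F.obj (H.obj N)) ≤ C * complexity t G (H.obj G) := by
  obtain ⟨T⟩ := hG N
  have hK : 3 * complexity t G (F.obj G) ≠ ⊤ :=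
    ENNReal.mul_ne_top (by simp) (hG.complexity_ne_top t _)
  refine ⟨3 * complexity t G (F.obj G) * (3 * T.value t),
    ENNReal.mul_ne_top hK (ENNReal.mul_ne_top (by simp) (T.value_ne_top t)), fun H hH => ?_⟩
  have h₁ : complexity t G (F.obj (H.obj N)) ≤
      3 * complexity t G (F.obj G) * complexity t G (H.obj N) := by
    have : Nonempty (Tower G (H.obj N)) := hG _
    change _ ≤ _ * ⨅ S : Tower G (H.obj N), S.value t
    rw [ENNReal.mul_iInf fun h => absurd h hK]
    exact le_iInf fun S => hF.complexity_le_tower G S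
  calc _ ≤ _ := h₁
    _ ≤ _ := mul_le_mul_right (hH.complexity_le_tower G T) _
    _ = _ := by ring

lemma fpow_comp_obj (F₁ F₂ : D ⥤ D) (n : ℕ) (X : D) :
    (fpow (F₁ ⋙ F₂) n).obj (F₂.obj X) = F₂.obj ((fpow (F₂ ⋙ F₁) n).obj X) := by
  induction n with
  | zero => rfl
  | succ n ih => simp [fpow, ih]

/-- The iterates of a conjugate are the conjugates of the iterates. -/
noncomputable def fpowConjIso (e : D ≌ D) (F : D ⥤ D) (X : D) :
    ∀ n, (fpow (e.inverse ⋙ F ⋙ e.functor) n).obj X ≅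
      e.functor.obj ((fpow F n).obj (e.inverse.obj X))
  | 0 => (e.counitIso.app X).symm
  | n + 1 => e.functor.mapIso (F.mapIso (e.inverse.mapIso (fpowConjIso e F X n) ≪≫
      (e.unitIso.app _).symm))

section Growth

variable {a b : ℕ → ℝ≥0∞} {d : ℕ}

lemma log_le_of_sub_mul_inv_lt {x : EReal} {p q z : ℝ} (hq : 0 < q)
    (h : (x - (p : EReal)) * ((q⁻¹ : ℝ) : EReal) < (z : EReal)) :
    x ≤ ((z * q + p : ℝ) : EReal) := by
  induction x with
  | bot => exact bot_le
  | top =>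
    rw [EReal.top_sub_coe, EReal.top_mul_coe_of_pos (inv_pos.mpr hq)] at h
    exact absurd h not_top_lt
  | coe x =>
    norm_cast at h ⊢
    rw [← div_eq_mul_inv, div_lt_iff₀ hq] at h
    linarith

lemma limsup_log_le_limsup_log (hab : ∃ C : ℝ≥0∞, C ≠ ⊤ ∧ ∀ n, a (n + d) ≤ C * b n)
    {p q : ℕ → ℝ} {k L : ℝ} (hp : ∀ n, p (n + d) = p n + k) (hq : Tendsto q atTop atTop)
    (hqd : Tendsto (fun n => q (n + d) - q n) atTop (𝓝 L)) :
    limsup (fun n => (ENNReal.log (a n) - (p n : EReal)) * (((q n)⁻¹ : ℝ) : EReal)) atTop ≤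
      limsup (fun n => (ENNReal.log (b n) - (p n : EReal)) * (((q n)⁻¹ : ℝ) : EReal)) atTop := by
  obtain ⟨C, hC, hab⟩ := hab
  obtain ⟨K, hK, -⟩ := EReal.lt_iff_exists_real_btwn.mp
    (lt_top_iff_ne_top.mpr (mt ENNReal.log_eq_top_iff.mp hC))
  have hq' : Tendsto (fun n => q (n + d)) atTop atTop :=
    hq.comp (tendsto_add_atTop_nat d)
  rw [← limsup_nat_add _ d]
  refine EReal.le_of_forall_lt_iff_le.mp fun z hz => ?_
  have hlim : Tendsto (fun n => (((K - k - z * (q (n + d) - q n)) * (q (n + d))⁻¹ + z : ℝ) :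
      EReal)) atTop (𝓝 (z : EReal)) := by
    refine continuous_coe_real_ereal.continuousAt.tendsto.comp ?_
    simpa using (((hqd.const_mul z).const_sub (K - k)).mul
      (tendsto_inv_atTop_zero.comp hq')).add_const z
  rw [← hlim.limsup_eq]
  refine limsup_le_limsup ?_
  filter_upwards [eventually_lt_of_limsup_lt hz, hq.eventually_gt_atTop 0,
    hq'.eventually_gt_atTop 0] with n hn hqn hqn'
  have hlog : ENNReal.log (a (n + d)) ≤ ((K + (z * q n + p n) : ℝ) : EReal) := by
    calc ENNReal.log (a (n + d)) ≤ ENNReal.log (C * b n) := ENNReal.log_monotone (hab n)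
      _ = ENNReal.log C + ENNReal.log (b n) := ENNReal.log_mul_add
      _ ≤ (K : EReal) + ((z * q n + p n : ℝ) : EReal) :=
        add_le_add hK.le (log_le_of_sub_mul_inv_lt hqn hn)
      _ = _ := by norm_cast
  calc _ ≤ (((K + (z * q n + p n) : ℝ) : EReal) - (p (n + d) : EReal)) *
        (((q (n + d))⁻¹ : ℝ) : EReal) :=
        mul_le_mul_of_nonneg_right (EReal.sub_le_sub hlog le_rfl)
          (by exact_mod_cast (inv_pos.mpr hqn').le)
    _ = _ := by
      norm_cast
      rw [hp]
      field_simp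
      ring

/-- Exponential growth rate of a sequence. -/
noncomputable def expGrowth (a : ℕ → ℝ≥0∞) : EReal :=
  limsup (fun n : ℕ => ENNReal.log (a n) * (((n : ℝ)⁻¹ : ℝ) : EReal)) atTop

/-- Polynomial growth rate of a sequence, relative to the exponential rate `h`. -/
noncomputable def polyGrowth (a : ℕ → ℝ≥0∞) (h : EReal) : EReal :=
  limsup (fun n : ℕ => (ENNReal.log (a n) - ((n : ℝ) : EReal) * h) *
    ((((Real.log n)⁻¹ : ℝ)) : EReal)) atTop

lemma expGrowth_le (hab : ∃ C : ℝ≥0∞, C ≠ ⊤ ∧ ∀ n, a (n + d) ≤ C * b n) :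
    expGrowth a ≤ expGrowth b := by
  simpa [expGrowth] using limsup_log_le_limsup_log hab (p := 0) (k := 0) (q := fun n => n)
    (L := d) (by simp) tendsto_natCast_atTop_atTop (by simp)

lemma polyGrowth_coe_le (hab : ∃ C : ℝ≥0∞, C ≠ ⊤ ∧ ∀ n, a (n + d) ≤ C * b n) (h : ℝ) :
    polyGrowth a h ≤ polyGrowth b h := by
  have hlog : Tendsto (fun n : ℕ => Real.log (n + d : ℕ) - Real.log n) atTop (𝓝 0) := by
    simpa [Function.comp_def] using (Real.tendsto_log_comp_add_sub_log d).comp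
      (tendsto_natCast_atTop_atTop (R := ℝ))
  simpa [polyGrowth] using limsup_log_le_limsup_log hab (p := fun n => n * h) (k := d * h)
    (q := fun n => Real.log n) (fun n => by push_cast; ring)
    (Real.tendsto_log_atTop.comp tendsto_natCast_atTop_atTop) hlog

lemma expGrowth_eq (hab : ∃ C : ℝ≥0∞, C ≠ ⊤ ∧ ∀ n, a (n + d) ≤ C * b n)
    (hba : ∃ C : ℝ≥0∞, C ≠ ⊤ ∧ ∀ n, b (n + d) ≤ C * a n) : expGrowth a = expGrowth b :=
  le_antisymm (expGrowth_le hab) (expGrowth_le hba)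

lemma polyGrowth_eq (hab : ∃ C : ℝ≥0∞, C ≠ ⊤ ∧ ∀ n, a (n + d) ≤ C * b n)
    (hba : ∃ C : ℝ≥0∞, C ≠ ⊤ ∧ ∀ n, b (n + d) ≤ C * a n) {h : EReal} (h_bot : h ≠ ⊥) :
    polyGrowth a h = polyGrowth b h := by
  induction h with
  | bot => exact absurd rfl h_bot
  | coe h => exact le_antisymm (polyGrowth_coe_le hab h) (polyGrowth_coe_le hba h)
  | top =>
    refine limsup_congr ?_
    filter_upwards [eventually_gt_atTop 0] with n hn
    rw [EReal.coe_mul_top_of_pos (by exact_mod_cast hn), EReal.sub_top, EReal.sub_top]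

lemma polyGrowth_bot_eq (h₀ : ∀ n, a n = 0 ↔ b n = 0) : polyGrowth a ⊥ = polyGrowth b ⊥ := by
  refine limsup_congr ?_
  filter_upwards [eventually_gt_atTop 0] with n hn
  rw [EReal.coe_mul_bot_of_pos (by exact_mod_cast hn)]
  by_cases ha : a n = 0
  · rw [ha, (h₀ n).mp ha]
  · have hb := mt (h₀ n).mpr ha
    rw [EReal.sub_bot (mt ENNReal.log_eq_bot_iff.mp ha),
      EReal.sub_bot (mt ENNReal.log_eq_bot_iff.mp hb)]

end Growth

lemma polyEntropy_eq_polyGrowth (t : ℝ) (F : D ⥤ D) (G : D) :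
    polyEntropy t F G = polyGrowth (fun n => complexity t G ((fpow F n).obj G))
      (expGrowth fun n => complexity t G ((fpow F n).obj G)) :=
  rfl

lemma IsSplitGenerator.exists_complexity_fpow_succ_le {G : D} (hG : IsSplitGenerator G) {t : ℝ}
    {F₁ F₂ : D ⥤ D} (h₁ : PreservesReach t F₁) (h₂ : PreservesReach t F₂) :
    ∃ C : ℝ≥0∞, C ≠ ⊤ ∧ ∀ n, complexity t G ((fpow (F₂ ⋙ F₁) (n + 1)).obj G) ≤
      C * complexity t G ((fpow (F₁ ⋙ F₂) n).obj G) := by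
  obtain ⟨C, hC, h⟩ := hG.exists_complexity_le h₁ (F₂.obj G)
  refine ⟨C, hC, fun n => ?_⟩
  have := h _ ((h₁.comp h₂).fpow n)
  rwa [fpow_comp_obj] at this

theorem polyEntropy_comp_comm {G : D} (hG : IsSplitGenerator G) {t : ℝ} {F₁ F₂ : D ⥤ D}
    (h₁ : PreservesReach t F₁) (h₂ : PreservesReach t F₂) (ht : entropy t (F₂ ⋙ F₁) G ≠ ⊥) :
    polyEntropy t (F₂ ⋙ F₁) G = polyEntropy t (F₁ ⋙ F₂) G := by
  have hab := hG.exists_complexity_fpow_succ_le h₁ h₂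
  have hba := hG.exists_complexity_fpow_succ_le h₂ h₁
  rw [polyEntropy_eq_polyGrowth, polyEntropy_eq_polyGrowth,
    ← expGrowth_eq (a := fun n => complexity t G ((fpow (F₂ ⋙ F₁) n).obj G))
      (b := fun n => complexity t G ((fpow (F₁ ⋙ F₂) n).obj G)) hab hba]
  exact polyGrowth_eq hab hba ht

theorem polyEntropy_conj {G : D} (hG : IsSplitGenerator G) {t : ℝ} {F : D ⥤ D} (e : D ≌ D)
    (he : PreservesReach t e.functor) (he' : PreservesReach t e.inverse)
    (hF : PreservesReach t F) :
    polyEntropy t (e.inverse ⋙ F ⋙ e.functor) G = polyEntropy t F G := by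
  have hab : ∃ C : ℝ≥0∞, C ≠ ⊤ ∧ ∀ n,
      complexity t G ((fpow (e.inverse ⋙ F ⋙ e.functor) n).obj G) ≤
        C * complexity t G ((fpow F n).obj G) := by
    obtain ⟨C, hC, h⟩ := hG.exists_complexity_le he (e.inverse.obj G)
    refine ⟨C, hC, fun n => ?_⟩
    rw [complexity_congr (fpowConjIso e F G n)]
    exact h _ (hF.fpow n)
  have hba : ∃ C : ℝ≥0∞, C ≠ ⊤ ∧ ∀ n, complexity t G ((fpow F n).obj G) ≤
      C * complexity t G ((fpow (e.inverse ⋙ F ⋙ e.functor) n).obj G) := by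
    obtain ⟨C, hC, h⟩ := hG.exists_complexity_le he' (e.functor.obj G)
    refine ⟨C, hC, fun n => ?_⟩
    have i : e.inverse.obj ((fpow (e.inverse ⋙ F ⋙ e.functor) n).obj (e.functor.obj G)) ≅
        (fpow F n).obj G :=
      e.inverse.mapIso (fpowConjIso e F _ n) ≪≫ (e.unitIso.app _).symm ≪≫
        (fpow F n).mapIso (e.unitIso.app G).symm
    rw [← complexity_congr i]
    exact h _ ((he'.comp (hF.comp he)).fpow n)
  rw [polyEntropy_eq_polyGrowth, polyEntropy_eq_polyGrowth,
    ← expGrowth_eq (a := fun n =>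
      complexity t G ((fpow (e.inverse ⋙ F ⋙ e.functor) n).obj G))
      (b := fun n => complexity t G ((fpow F n).obj G)) (d := 0) hab hba]
  by_cases h : expGrowth (fun n =>
      complexity t G ((fpow (e.inverse ⋙ F ⋙ e.functor) n).obj G)) = ⊥
  · rw [h]
    refine polyGrowth_bot_eq fun n => ⟨fun h₀ => ?_, fun h₀ => ?_⟩
    · obtain ⟨C, -, hC⟩ := hba
      simpa [h₀] using hC n
    · obtain ⟨C, -, hC⟩ := hab
      simpa [h₀] using hC n
  · exact polyGrowth_eq (d := 0) hab hba h

/-- Commutation invariance: `h^pol_t(F₁ ∘ F₂) = h^pol_t(F₂ ∘ F₁)`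
(where `F₁ ∘ F₂ = F₂ ⋙ F₁` applies `F₂` first), for every `t` with
`h_t(F₁ ∘ F₂) ≠ -∞`. In particular, if `F₁` is an autoequivalence then
`h^pol_t(F₁ ∘ F₂ ∘ F₁⁻¹) = h^pol_t(F₂)`. -/
theorem statement_5 {D : Type u} [Category.{v} D] [HasZeroObject D] [Preadditive D]
    [HasShift D ℤ] [∀ n : ℤ, (CategoryTheory.shiftFunctor D n).Additive] [Pretriangulated D]
    [HasBinaryBiproducts D]
    (F₁ F₂ : D ⥤ D) [F₁.CommShift ℤ] [F₁.IsTriangulated] [F₂.CommShift ℤ] [F₂.IsTriangulated]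
    (h₁₂ : NotVirtuallyZero (F₂ ⋙ F₁)) (h₂₁ : NotVirtuallyZero (F₁ ⋙ F₂))
    (G : D) (hG : IsSplitGenerator G) (t : ℝ)
    (ht : entropy t (F₂ ⋙ F₁) G ≠ ⊥) :
    polyEntropy t (F₂ ⋙ F₁) G = polyEntropy t (F₁ ⋙ F₂) G ∧
    (∀ e : D ≌ D, e.functor = F₁ →
      polyEntropy t (e.inverse ⋙ F₂ ⋙ e.functor) G = polyEntropy t F₂ G) := by
  refine ⟨polyEntropy_comp_comm hG (.of_isTriangulated F₁) (.of_isTriangulated F₂) ht, ?_⟩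
  rintro e rfl
  exact polyEntropy_conj hG e (.of_isTriangulated _) (.inverse e) (.of_isTriangulated F₂)

end CatDyn
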